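/- Let N ≥ 1, k ≥ 1, let χ be a Dirichlet character modulo N, and let f be a nonzero element of M_k(Γ₀(N), χ). Then every field automorphism σ of ℂ that fixes the Fourier coefficients a_n(f) for all n ≥ 1 also fixes χ(u) for every integer u; in other words, the subfield ℚ(χ) of ℂ generated by the values of χ is contained in K_f. -/

import Mathlib

open Complex UpperHalfPlane CongruenceSubgroup
open scoped ModularForm MatrixGroups Real Manifold

noncomputable section

/-- `f` has the Fourier expansion `Σ_{n ≥ 0} c n · e^{2πinτ/N}`. -/
def HasExpansion (N : ℕ) (f : ℍ → ℂ) (c : ℕ → ℂ) : Prop :=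
  ∀ τ : ℍ, HasSum (fun n : ℕ => c n * Complex.exp (2 * Real.pi * Complex.I * n * (τ : ℂ) / N)) (f τ)

local notation "𝕢" => Function.Periodic.qParam

/-- pairs (function, expansion) -/
def expSub (N : ℕ) [NeZero N] : Subring ((ℍ → ℂ) × PowerSeries ℂ) where
  carrier := {x | ∀ τ : ℍ, HasSum (fun n : ℕ => x.2.coeff n * 𝕢 N τ ^ n) (x.1 τ)}
  mul_mem' {x y} hx hy τ := by
    have h1 := hx τ
    have h2 := hy τ
    have := h1.summable.norm.hasSum
    have key := tsum_mul_tsum_eq_tsum_sum_antidiagonal_of_summable_norm h1.summable.norm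
      h2.summable.norm
    have ks := summable_norm_sum_mul_antidiagonal_of_summable_norm h1.summable.norm
      h2.summable.norm
    have e : ∀ n, ∑ kl ∈ Finset.HasAntidiagonal.antidiagonal n, x.2.coeff kl.1 * 𝕢 N τ ^ kl.1 *
        (y.2.coeff kl.2 * 𝕢 N τ ^ kl.2) = (x * y).2.coeff n * 𝕢 N τ ^ n := by
      intro n
      rw [Prod.snd_mul, PowerSeries.coeff_mul, Finset.sum_mul]
      refine Finset.sum_congr rfl fun kl hkl => ?_
      rw [← Finset.HasAntidiagonal.mem_antidiagonal.mp hkl, pow_add]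
      ring
    simp only [e] at key ks
    rw [h1.tsum_eq, h2.tsum_eq] at key
    have := ks.of_norm.hasSum
    rw [← key] at this
    exact this
  one_mem' τ := by
    have := hasSum_single (f := fun n : ℕ => (1 : PowerSeries ℂ).coeff n * 𝕢 N τ ^ n) 0 (by
      intro n hn; simp [PowerSeries.coeff_one, hn])
    simpa using this
  add_mem' {x y} hx hy τ := by
    simpa [add_mul] using (hx τ).add (hy τ)
  zero_mem' τ := by simp
  neg_mem' {x} hx τ := by simpa using (hx τ).neg

lemma mem_expSub {N : ℕ} [NeZero N] {x : (ℍ → ℂ) × PowerSeries ℂ} :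
    x ∈ expSub N ↔ ∀ τ : ℍ, HasSum (fun n : ℕ => x.2.coeff n * 𝕢 N τ ^ n) (x.1 τ) := Iff.rfl

lemma expSub_unique {N : ℕ} [NeZero N] {F : ℍ → ℂ} {p p' : PowerSeries ℂ}
    (h : (F, p) ∈ expSub N) (h' : (F, p') ∈ expSub N) : p = p' := by
  have h0 : ((0 : ℍ → ℂ), p - p') ∈ expSub N := by simpa using sub_mem h h'
  have hN : (0 : ℝ) < N := by exact_mod_cast Nat.pos_of_ne_zero (NeZero.ne N)
  have := UpperHalfPlane.qExpansion_coeff_unique (h := (N : ℝ)) (0 : ModularForm 𝒮ℒ 0) hN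
    (by
      have : UpperHalfPlane.cuspFunction (N : ℝ) (0 : ℍ → ℂ) = 0 := by
        simpa [cuspFunction, Function.Periodic.cuspFunction]
          using! (tendsto_const_nhds.mono_left nhdsWithin_le_nhds).limUnder_eq
      rw [FunLike.coe_zero, this]; exact analyticAt_const) (c := fun n => (p - p').coeff n) h0
  rw [FunLike.coe_zero, UpperHalfPlane.qExpansion_zero] at this
  rw [← sub_eq_zero]
  ext n
  simpa using this n

lemma expSub_zero {N : ℕ} [NeZero N] {F : ℍ → ℂ} (h : (F, (0 : PowerSeries ℂ)) ∈ expSub N) :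
    F = 0 := by
  ext τ
  have := h τ
  simp only [map_zero, zero_mul] at this
  exact this.unique hasSum_zero

lemma expSub_const {N : ℕ} [NeZero N] (c : ℂ) :
    ((fun _ => c), PowerSeries.C c) ∈ expSub N := by
  intro τ
  have := hasSum_single (f := fun n : ℕ => (PowerSeries.C c).coeff n * 𝕢 N τ ^ n) 0 (by
      intro n hn; simp [PowerSeries.coeff_C, hn])
  simpa using this

lemma expSub_bdd {N : ℕ} [NeZero N] {F : ℍ → ℂ} {p : PowerSeries ℂ}
    (h : (F, p) ∈ expSub N) : IsBoundedAtImInfty F := by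
  have hN : (0 : ℝ) < N := by exact_mod_cast Nat.pos_of_ne_zero (NeZero.ne N)
  exact UpperHalfPlane.isBoundedAtImInfty_of_hasSum_qExpansion hN (c := fun n => p.coeff n) h

lemma expSub_holo {N : ℕ} [NeZero N] {F : ℍ → ℂ} {p : PowerSeries ℂ}
    (h : (F, p) ∈ expSub N) : MDiff F := by
  have hN : (0 : ℝ) < N := by exact_mod_cast Nat.pos_of_ne_zero (NeZero.ne N)
  set P := FormalMultilinearSeries.ofScalars (𝕜 := ℂ) ℂ (fun n => p.coeff n) with hP
  have hs : ∀ z : ℂ, ‖z‖ < 1 → z ≠ 0 → Summable fun n => p.coeff n * z ^ n := by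
    intro z hz hz0
    have := (h ⟨_, Function.Periodic.im_invQParam_pos_of_norm_lt_one hN hz hz0⟩).summable
    simpa only [UpperHalfPlane.coe_mk, Function.Periodic.qParam_right_inv hN.ne' hz0] using this
  have hr : 1 ≤ P.radius := by
    refine ENNReal.le_of_forall_nnreal_lt fun r hr => ?_
    rcases eq_or_ne r 0 with rfl | hr0
    · simp
    refine P.le_radius_of_summable ?_
    have := (hs (r : ℂ) (by simpa using hr) (by simpa using hr0)).norm
    refine this.congr fun n => ?_
    simp [hP]
  have hd : DifferentiableOn ℂ P.sum (Metric.eball 0 1) :=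
    ((P.hasFPowerSeriesOnBall (lt_of_lt_of_le one_pos hr)).mono one_pos hr).differentiableOn
  rw [UpperHalfPlane.mdifferentiable_iff]
  have : Set.EqOn (F ∘ ofComplex) (fun z => P.sum (𝕢 N z)) {z | 0 < z.im} := by
    intro z hz
    simp only [Function.comp, ofComplex_apply_of_im_pos hz]
    refine (h ⟨z, hz⟩).tsum_eq.symm.trans ?_
    simp [FormalMultilinearSeries.sum, hP, FormalMultilinearSeries.ofScalars_apply_eq, mul_comm]
  refine DifferentiableOn.congr ?_ this
  refine hd.comp (Differentiable.differentiableOn ?_) ?_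
  · exact Function.Periodic.differentiable_qParam
  · intro z hz
    have := Function.Periodic.norm_qParam_lt_one hN (z := z) hz
    simpa [Metric.mem_eball, edist_zero_right, enorm_eq_nnnorm, ← NNReal.coe_lt_coe] using this

lemma mul_eq_zero_holo {F G : ℍ → ℂ} (hF : MDiff F) (hG : MDiff G)
    (h : F * G = 0) : F = 0 ∨ G = 0 := by
  rw [UpperHalfPlane.mdifferentiable_iff] at hF hG
  have ho : IsOpen {z : ℂ | 0 < z.im} := isOpen_lt continuous_const Complex.continuous_im
  have hc : IsPreconnected {z : ℂ | 0 < z.im} := (convex_halfSpace_im_gt 0).isPreconnected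
  have key := AnalyticOnNhd.eq_zero_or_eq_zero_of_smul_eq_zero (hF.analyticOnNhd ho) (hG.analyticOnNhd ho) (by
    intro z hz
    exact congrFun h (ofComplex z)) hc
  refine key.imp ?_ ?_ <;>
  · intro h
    ext τ
    simpa using h τ τ.im_pos

lemma expSub_mul {N : ℕ} [NeZero N] {F G : ℍ → ℂ} {p q : PowerSeries ℂ}
    (h : (F, p) ∈ expSub N) (h' : (G, q) ∈ expSub N) : (F * G, p * q) ∈ expSub N := by
  rw [← Prod.mk_mul_mk]; exact mul_mem h h'

lemma expSub_add {N : ℕ} [NeZero N] {F G : ℍ → ℂ} {p q : PowerSeries ℂ}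
    (h : (F, p) ∈ expSub N) (h' : (G, q) ∈ expSub N) : (F + G, p + q) ∈ expSub N := by
  rw [← Prod.mk_add_mk]; exact add_mem h h'

lemma expSub_neg {N : ℕ} [NeZero N] {F : ℍ → ℂ} {p : PowerSeries ℂ}
    (h : (F, p) ∈ expSub N) : (-F, -p) ∈ expSub N := by
  rw [← Prod.neg_mk]; exact neg_mem h

/-- pairs `(F, F^σ)` -/
def relSub (N : ℕ) [NeZero N] (σ : ℂ ≃+* ℂ) : Subring ((ℍ → ℂ) × (ℍ → ℂ)) where
  carrier := {x | ∃ p : PowerSeries ℂ, (x.1, p) ∈ expSub N ∧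
    (x.2, PowerSeries.map (σ : ℂ →+* ℂ) p) ∈ expSub N}
  mul_mem' := by
    rintro x y ⟨p, hp, hp'⟩ ⟨q, hq, hq'⟩
    exact ⟨p * q, expSub_mul hp hq, by rw [map_mul]; exact expSub_mul hp' hq'⟩
  one_mem' := ⟨1, (expSub N).one_mem, by rw [map_one]; exact (expSub N).one_mem⟩
  add_mem' := by
    rintro x y ⟨p, hp, hp'⟩ ⟨q, hq, hq'⟩
    exact ⟨p + q, expSub_add hp hq, by rw [map_add]; exact expSub_add hp' hq'⟩
  zero_mem' := ⟨0, (expSub N).zero_mem, by rw [map_zero]; exact (expSub N).zero_mem⟩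
  neg_mem' := by
    rintro x ⟨p, hp, hp'⟩
    exact ⟨-p, expSub_neg hp, by rw [map_neg]; exact expSub_neg hp'⟩

lemma relSub_unique {N : ℕ} [NeZero N] {σ : ℂ ≃+* ℂ} {F G H : ℍ → ℂ}
    (h : (F, G) ∈ relSub N σ) (h' : (F, H) ∈ relSub N σ) : G = H := by
  obtain ⟨p, hp, hp'⟩ := h
  obtain ⟨q, hq, hq'⟩ := h'
  simp only at hp hp' hq hq'
  rw [← expSub_unique hp hq] at hq'
  have := sub_mem hp' hq'
  simp only [Prod.mk_sub_mk, sub_self] at this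
  exact sub_eq_zero.mp (expSub_zero this)

lemma relSub_const {N : ℕ} [NeZero N] {σ : ℂ ≃+* ℂ} (c : ℂ) :
    ((fun _ => c), (fun _ => σ c)) ∈ relSub N σ :=
  ⟨PowerSeries.C c, expSub_const c, by
    have := expSub_const (N := N) (σ c)
    simpa using this⟩

/-- change of level -/
lemma expSub_of_one {N : ℕ} [NeZero N] {F : ℍ → ℂ} {p : PowerSeries ℂ}
    (h : (F, p) ∈ expSub 1) :
    (F, PowerSeries.mk fun n => if N ∣ n then p.coeff (n / N) else 0) ∈ expSub N := by
  intro τ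
  have h1 := h τ
  have hN : N ≠ 0 := NeZero.ne N
  have hinj : Function.Injective (fun n : ℕ => N * n) := fun a b hab =>
    Nat.eq_of_mul_eq_mul_left (Nat.pos_of_ne_zero hN) hab
  refine (hinj.hasSum_iff ?_).mp ?_
  · intro n hn
    have : ¬ N ∣ n := by
      rintro ⟨m, rfl⟩; exact hn ⟨m, rfl⟩
    simp [this]
  · refine h1.congr_fun ?_ |> fun x => x
    intro n
    simp only [Function.comp, PowerSeries.coeff_mk, dvd_mul_right, if_true,
      Nat.mul_div_cancel_left _ (Nat.pos_of_ne_zero hN)]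
    rw [pow_mul]
    congr 2
    simp only [Function.Periodic.qParam, ← Complex.exp_nat_mul]
    congr 1
    have : (N : ℂ) ≠ 0 := by exact_mod_cast hN
    push_cast
    field_simp

lemma relSub_of_one {N : ℕ} [NeZero N] {σ : ℂ ≃+* ℂ} {x : (ℍ → ℂ) × (ℍ → ℂ)}
    (h : x ∈ relSub 1 σ) : x ∈ relSub N σ := by
  obtain ⟨p, hp, hp'⟩ := h
  refine ⟨_, expSub_of_one hp, ?_⟩
  convert expSub_of_one (N := N) hp' using 2
  ext n
  simp only [PowerSeries.coeff_map, PowerSeries.coeff_mk]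
  split_ifs <;> simp

lemma hasExpansion_iff {N : ℕ} [NeZero N] {F : ℍ → ℂ} {c : ℕ → ℂ} :
    HasExpansion N F c ↔ (F, PowerSeries.mk c) ∈ expSub N := by
  unfold HasExpansion
  rw [mem_expSub]
  refine forall_congr' fun τ => ?_
  simp only [PowerSeries.coeff_mk, Function.Periodic.qParam, ← Complex.exp_nat_mul]
  have : ∀ n : ℕ, (2 * π * Complex.I * n * (τ : ℂ) / N) = (n * (2 * π * Complex.I * (τ : ℂ) / ((N : ℝ) : ℂ))) := by
    intro n; push_cast; ring
  simp only [this]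

/-- weight `k` level one functional equation -/
def WInv (k : ℤ) (T : ℍ → ℂ) : Prop := ∀ (g : SL(2, ℤ)) (τ : ℍ), T (g • τ) = denom g τ ^ k * T τ

lemma inv_of_form {k : ℤ} (T : ModularForm 𝒮ℒ k) : WInv k T := by
  intro g τ
  exact SlashInvariantForm.slash_action_eqn'' T (γ := (g : GL (Fin 2) ℝ)) (by exact ⟨g, rfl⟩) τ

lemma expSub_form {k : ℤ} (T : ModularForm 𝒮ℒ k) : (⇑T, qExpansion 1 T) ∈ expSub 1 := by
  intro τ
  have := ModularForm.hasSum_qExpansion T one_pos one_mem_strictPeriods_SL τ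
  simpa using this

lemma relSub_E {σ : ℂ ≃+* ℂ} {k : ℕ} (hk : 3 ≤ k) (hk2 : Even k) :
    (⇑(ModularForm.E hk), ⇑(ModularForm.E hk)) ∈ relSub 1 σ := by
  refine ⟨_, expSub_form _, ?_⟩
  convert expSub_form (ModularForm.E hk) using 2
  ext n
  rw [PowerSeries.coeff_map, EisensteinSeries.E_qExpansion_coeff hk hk2]
  have h2 : σ 2 = 2 := map_ofNat σ 2
  split_ifs <;> simp [h2]

lemma relSub_disc {σ : ℂ ≃+* ℂ} :
    (ModularForm.discriminant, ModularForm.discriminant) ∈ relSub 1 σ := by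
  have h4 := relSub_E (σ := σ) (k := 4) (by norm_num) ⟨2, rfl⟩
  have h6 := relSub_E (σ := σ) (k := 6) (by norm_num) ⟨3, rfl⟩
  have hc := relSub_const (N := 1) (σ := σ) (1 / 1728)
  have := mul_mem (sub_mem (pow_mem h4 3) (pow_mem h6 2)) hc
  convert this using 1
  have h2 : σ 1728 = 1728 := map_ofNat σ 1728
  ext z <;> simp [h2, ModularForm.discriminant_eq_E₄_cube_sub_E₆_sq, div_eq_mul_inv]

lemma levelOne_conj_aux (σ : ℂ ≃+* ℂ) (n : ℕ) : ∀ (k : ℤ) (_ : k < n) (T : ModularForm 𝒮ℒ k),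
    ∃ T' : ℍ → ℂ, (⇑T, T') ∈ relSub 1 σ ∧ WInv k T' := by
  have hz : ∀ (k : ℤ) (T : ModularForm 𝒮ℒ k), ⇑T = 0 → 
      ∃ T' : ℍ → ℂ, (⇑T, T') ∈ relSub 1 σ ∧ WInv k T' := by
    intro k T h
    exact ⟨0, by rw [h]; exact zero_mem _, fun g τ => by simp⟩
  induction n with
  | zero =>
    intro k hk T
    exact hz k T (ModularFormClass.levelOne_neg_weight_eq_zero (by simpa using hk) T)
  | succ n ih =>
    intro k hk T
    rcases Int.even_or_odd k with he | ho
    swap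
    · exact hz k T (by rw [ModularForm.levelOne_odd_weight_eq_zero ho T]; rfl)
    rcases lt_or_ge k 0 with h0 | h0
    · exact hz k T (ModularFormClass.levelOne_neg_weight_eq_zero h0 T)
    lift k to ℕ using h0
    have he : Even k := by exact_mod_cast he
    rcases lt_or_ge k 3 with h3 | h3
    · have : k = 0 ∨ k = 2 := by
        obtain ⟨r, rfl⟩ := he
        omega
      rcases this with rfl | rfl
      · obtain ⟨c, hc⟩ := ModularFormClass.levelOne_weight_zero_const (F := ModularForm 𝒮ℒ 0) T
        refine ⟨fun _ => σ c, ?_, fun g τ => by simp⟩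
        have := relSub_const (N := 1) (σ := σ) c
        rw [hc]; exact this
      · exact hz _ T (by rw [rank_zero_iff_forall_zero.mp ModularForm.levelOne_weight_two_rank_zero T]; rfl)
    · have hcusp := ModularForm.sub_smul_isCuspForm T (ModularForm.E h3)
        (EisensteinSeries.E_qExpansion_coeff_zero h3 he)
      set c := (qExpansion 1 T).coeff 0
      rw [ModularForm.isCuspForm_iff_coeffZero_eq_zero] at hcusp
      set S := CuspForm.discriminantEquiv (ModularForm.toCuspForm _ hcusp) with hS
      obtain ⟨S', hS', hi⟩ := ih _ (by omega) S
      have hD := ModularForm.discriminant_mul_discriminantEquiv (ModularForm.toCuspForm _ hcusp)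
      rw [← hS] at hD
      have hT : ⇑T = ModularForm.discriminant * ⇑S + (fun _ => c) * ⇑(ModularForm.E h3) := by
        rw [hD]
        ext τ
        simp
      refine ⟨ModularForm.discriminant * S' + (fun _ => σ c) * ⇑(ModularForm.E h3), ?_, ?_⟩
      · rw [hT]
        exact add_mem (mul_mem relSub_disc hS') (mul_mem (relSub_const c) (relSub_E h3 he))
      · intro g τ
        have h1 := inv_of_form (ModularForm.E h3) g τ
        have h2 := inv_of_form (CuspForm.discriminant : ModularForm 𝒮ℒ 12) g τ
        have h3 := hi g τ
        simp only [Pi.add_apply, Pi.mul_apply, h1, h3]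
        have h2' : ModularForm.discriminant (g • τ) = denom g τ ^ (12 : ℤ) * ModularForm.discriminant τ := h2
        rw [h2']
        have : denom g τ ^ (k : ℤ) = denom g τ ^ (12 : ℤ) * denom g τ ^ ((k : ℤ) - 12) := by
          rw [← zpow_add₀ (denom_ne_zero _ _)]; congr 1; ring
        rw [this]; ring

lemma levelOne_conj (σ : ℂ ≃+* ℂ) (k : ℤ) (T : ModularForm 𝒮ℒ k) :
    ∃ T' : ℍ → ℂ, (⇑T, T') ∈ relSub 1 σ ∧ WInv k T' :=
  levelOne_conj_aux σ (k.toNat + 1) k (by have := Int.self_le_toNat k; push_cast; omega) T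

lemma expSub_of_hasSum {N : ℕ} [NeZero N] {ι : Type} (e : ι → ℕ)
    (hfin : ∀ r, {i | e i = r}.Finite) (c : ι → ℂ) (F : ℍ → ℂ)
    (h : ∀ τ : ℍ, HasSum (fun i => c i * 𝕢 N τ ^ e i) (F τ)) :
    (F, PowerSeries.mk fun r => ∑ i ∈ (hfin r).toFinset, c i) ∈ expSub N := by
  intro τ
  have h1 := h τ
  rw [← (Equiv.sigmaFiberEquiv e).hasSum_iff] at h1
  refine (h1.sigma (g := fun r => (∑ i ∈ (hfin r).toFinset, c i) * 𝕢 N τ ^ r) ?_).congr_fun ?_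
  · intro r
    have : Fintype {i // e i = r} := (hfin r).fintype
    have := hasSum_fintype (fun i : {i // e i = r} => c i * 𝕢 N τ ^ e i)
    convert this using 1
    · rfl
    rw [Finset.sum_mul]
    rw [Finset.sum_subtype _ (p := fun i => e i = r) (by simp)]
    exact Finset.sum_congr rfl fun i _ => by rw [i.2]
  · intro r; simp

lemma relSub_of_hasSum {N : ℕ} [NeZero N] {σ : ℂ ≃+* ℂ} {ι : Type} (e : ι → ℕ)
    (hfin : ∀ r, {i | e i = r}.Finite) (c c' : ι → ℂ) (hc : ∀ i, σ (c i) = c' i) (F F' : ℍ → ℂ)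
    (h : ∀ τ : ℍ, HasSum (fun i => c i * 𝕢 N τ ^ e i) (F τ))
    (h' : ∀ τ : ℍ, HasSum (fun i => c' i * 𝕢 N τ ^ e i) (F' τ)) :
    (F, F') ∈ relSub N σ := by
  refine ⟨_, expSub_of_hasSum e hfin c F h, ?_⟩
  convert expSub_of_hasSum e hfin c' F' h' using 2
  ext n
  simp [hc]

/-- `∑ n² wⁿ` -/
def Phi (w : ℂ) : ℂ := w * (1 + w) / (1 - w) ^ 3

lemma hasSum_Phi {w : ℂ} (hw : ‖w‖ < 1) : HasSum (fun n : ℕ => (n : ℂ) ^ 2 * w ^ n) (Phi w) := by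
  have h0 := (hasSum_choose_mul_geometric_of_norm_lt_one 0 hw)
  have h1 := (hasSum_choose_mul_geometric_of_norm_lt_one 1 hw)
  have h2 := (hasSum_choose_mul_geometric_of_norm_lt_one 2 hw)
  have hne : 1 - w ≠ 0 := by
    intro h
    rw [← sub_eq_zero.mp h] at hw
    simp at hw
  have := ((h2.mul_left 2).sub (h1.mul_left 3)).add h0
  convert! this using 1
  · funext n
    have h2 : (((n + 2).choose 2 : ℕ) : ℂ) = (n + 2) * (n + 1) / 2 := by
      rw [Nat.cast_choose_two]; push_cast; ring
    rw [h2]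
    simp
    ring
  · unfold Phi
    field_simp
    ring

/-- the constant `(-2πi)³/2` -/
def lam : ℂ := (-2 * π * Complex.I) ^ 3 / 2

lemma lam_ne : lam ≠ 0 := by
  simp [lam, Real.pi_ne_zero, Complex.I_ne_zero]

lemma lip_uhp (z : ℍ) : ∑' n : ℤ, 1 / ((z : ℂ) + n) ^ 3 =
    lam * ∑' n : ℕ, (n : ℂ) ^ 2 * Complex.exp (2 * π * Complex.I * z) ^ n := by
  have := EisensteinSeries.qExpansion_identity (k := 2) (by norm_num) z
  simpa [lam] using this

lemma norm_exp_uhp (z : ℍ) : ‖Complex.exp (2 * π * Complex.I * z)‖ < 1 :=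
  UpperHalfPlane.norm_exp_two_pi_I_lt_one z

lemma lip_real (x : ℝ) (hx : ∀ n : ℤ, (x : ℝ) + n ≠ 0) : ∑' n : ℤ, 1 / ((x : ℂ) + n) ^ 3 =
    lam * Phi (Complex.exp (2 * π * Complex.I * x)) := by
  have hl : Filter.Tendsto (fun y : ℝ => ∑' n : ℤ, 1 / ((x : ℂ) + y * Complex.I + n) ^ 3) 
      (nhdsWithin 0 (Set.Ioi 0)) (nhds (∑' n : ℤ, 1 / ((x : ℂ) + n) ^ 3)) := by
    refine tendsto_tsum_of_dominated_convergence (bound := fun n : ℤ => 1 / |x + n| ^ 3) ?_ ?_ ?_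
    · have h1 : (fun n : ℤ => 1 / |x + n| ^ 3) =O[Filter.cofinite] fun n : ℤ => ‖((n : ℝ)⁻¹) ^ 3‖ := by
        have := ((EisensteinSeries.linear_inv_isBigO_right 1 x).pow 3).norm_norm
        convert this using 2 with n
        simp
        norm_cast
      refine summable_of_isBigO ?_ h1
      have := (Real.summable_one_div_int_pow (p := 3)).mpr (by norm_num)
      simpa using this.norm
    · intro n
      have hne : (x : ℂ) + n ≠ 0 := by exact_mod_cast hx n
      have : ContinuousAt (fun y : ℝ => 1 / ((x : ℂ) + y * Complex.I + n) ^ 3) 0 := by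
        refine ContinuousAt.div continuousAt_const (by fun_prop) ?_
        simpa using hne
      have := this.tendsto.mono_left (nhdsWithin_le_nhds (s := Set.Ioi 0))
      simpa using this
    · filter_upwards with y n
      rw [norm_div, norm_one, norm_pow]
      have hp : 0 < |x + n| := abs_pos.mpr (hx n)
      have : |x + n| ≤ ‖(x : ℂ) + y * Complex.I + n‖ := by
        have := Complex.abs_re_le_norm ((x : ℂ) + y * Complex.I + n)
        simpa using this
      gcongr
  have hr : Filter.Tendsto (fun y : ℝ => lam * Phi (Complex.exp (2 * π * Complex.I * (x + y * Complex.I)))) 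
      (nhdsWithin 0 (Set.Ioi 0)) (nhds (lam * Phi (Complex.exp (2 * π * Complex.I * x)))) := by
    have hne : 1 - Complex.exp (2 * π * Complex.I * x) ≠ 0 := by
      intro h
      have := sub_eq_zero.mp h
      obtain ⟨n, hn⟩ := Complex.exp_eq_one_iff.mp this.symm
      have h2 : (2 * π * Complex.I) ≠ 0 := Complex.two_pi_I_ne_zero
      have : (x : ℂ) = n := by
        apply mul_left_cancel₀ h2; rw [hn]; ring
      have : x = n := by exact_mod_cast this
      apply hx (-n); rw [this]; push_cast; ring
    have : ContinuousAt (fun y : ℝ => lam * Phi (Complex.exp (2 * π * Complex.I * (x + y * Complex.I)))) 0 := by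
      unfold Phi
      refine ContinuousAt.mul continuousAt_const (ContinuousAt.div (by fun_prop) (by fun_prop) ?_)
      simpa using hne
    have := this.tendsto.mono_left (nhdsWithin_le_nhds (s := Set.Ioi 0))
    simpa using this
  refine tendsto_nhds_unique hl (hr.congr' ?_)
  filter_upwards [self_mem_nhdsWithin] with y hy
  have hy : 0 < y := hy
  have := lip_uhp ⟨x + y * Complex.I, by simpa using hy⟩
  have hs := (hasSum_Phi (norm_exp_uhp ⟨x + y * Complex.I, by simpa using hy⟩)).tsum_eq
  rw [hs] at this
  exact this.symm

/-- row vector times matrix mod `N` -/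
def act {N : ℕ} (v : Fin 2 → ZMod N) (g : SL(2, ℤ)) : Fin 2 → ZMod N :=
  fun j => v 0 * ((g 0 j : ℤ) : ZMod N) + v 1 * ((g 1 j : ℤ) : ZMod N)

lemma act_mul {N : ℕ} (v : Fin 2 → ZMod N) (g h : SL(2, ℤ)) : act (act v g) h = act v (g * h) := by
  ext j
  simp [act, Matrix.SpecialLinearGroup.coe_mul, Matrix.mul_apply, Fin.sum_univ_two]
  ring

lemma act_one {N : ℕ} (v : Fin 2 → ZMod N) : act v 1 = v := by
  ext j
  fin_cases j <;> simp [act]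

/-- `act` as a permutation -/
def actEquiv {N : ℕ} (g : SL(2, ℤ)) : (Fin 2 → ZMod N) ≃ (Fin 2 → ZMod N) where
  toFun v := act v g
  invFun v := act v g⁻¹
  left_inv v := by dsimp only; rw [act_mul, mul_inv_cancel, act_one]
  right_inv v := by dsimp only; rw [act_mul, inv_mul_cancel, act_one]

/-- row vectors of integers -/
def vecEquiv (g : SL(2, ℤ)) : (Fin 2 → ℤ) ≃ (Fin 2 → ℤ) where
  toFun v := Matrix.vecMul v (g : Matrix (Fin 2) (Fin 2) ℤ)
  invFun v := Matrix.vecMul v ((g⁻¹ : SL(2, ℤ)) : Matrix (Fin 2) (Fin 2) ℤ)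
  left_inv v := by
    dsimp only; rw [Matrix.vecMul_vecMul, ← Matrix.SpecialLinearGroup.coe_mul, mul_inv_cancel]; simp
  right_inv v := by
    dsimp only; rw [Matrix.vecMul_vecMul, ← Matrix.SpecialLinearGroup.coe_mul, inv_mul_cancel]; simp

/-- reduction -/
def red (N : ℕ) (p : Fin 2 → ℤ) : Fin 2 → ZMod N := fun i => (p i : ZMod N)

lemma red_vec {N : ℕ} (p : Fin 2 → ℤ) (g : SL(2, ℤ)) : red N (vecEquiv g p) = act (red N p) g := by
  ext j
  simp [red, act, vecEquiv, Matrix.vecMul, dotProduct, Fin.sum_univ_two]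

/-- normalized weight 3 Eisenstein series -/
def eX {N : ℕ} (v : Fin 2 → ZMod N) (τ : ℍ) : ℂ :=
  (N : ℂ) ^ 3 / lam * ∑' p : Fin 2 → ℤ, if red N p = v then EisensteinSeries.eisSummand 3 p τ else 0

lemma eX_smul {N : ℕ} (v : Fin 2 → ZMod N) (g : SL(2, ℤ)) (τ : ℍ) :
    eX v (g • τ) = denom g τ ^ 3 * eX (act v g) τ := by
  unfold eX
  rw [mul_left_comm]
  congr 1
  rw [← tsum_mul_left, ← (vecEquiv g).tsum_eq (fun p => denom g τ ^ 3 *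
    if red N p = act v g then EisensteinSeries.eisSummand 3 p τ else 0)]
  refine tsum_congr fun p => ?_
  rw [red_vec]
  have : act (red N p) g = act v g ↔ red N p = v := (actEquiv g).injective.eq_iff
  simp only [this]
  split_ifs
  · rw [EisensteinSeries.eisSummand_SL2_apply]; rfl
  · simp

/-- partial sums -/
def pS {N : ℕ} (d : ZMod N) (z : ℂ) : ℂ := ∑' n : ℤ, if (n : ZMod N) = d then 1 / (z + n) ^ 3 else 0

lemma pS_neg {N : ℕ} (d : ZMod N) (z : ℂ) : pS d (-z) = - pS (-d) z := by
  unfold pS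
  rw [← (Equiv.neg ℤ).tsum_eq, ← tsum_neg]
  refine tsum_congr fun n => ?_
  simp only [Equiv.neg_apply, Int.cast_neg, neg_eq_iff_eq_neg (a := (n : ZMod N))]
  split_ifs
  · rw [← neg_add, Odd.neg_pow (by decide)]; simp [div_neg]
  · simp

lemma pS_eq {N : ℕ} [NeZero N] (d : ZMod N) (z : ℂ) :
    pS d z = (1 / (N : ℂ) ^ 3) * ∑' l : ℤ, 1 / ((z + d.val) / N + l) ^ 3 := by
  have hN : (N : ℂ) ≠ 0 := by exact_mod_cast NeZero.ne N
  have hN' : (N : ℤ) ≠ 0 := by exact_mod_cast NeZero.ne N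
  unfold pS
  have hinj : Function.Injective (fun l : ℤ => (d.val : ℤ) + N * l) := by
    intro a b hab
    simpa [NeZero.ne N] using hab
  rw [← hinj.tsum_eq, ← tsum_mul_left]
  · refine tsum_congr fun l => ?_
    have : (((d.val : ℤ) + N * l : ℤ) : ZMod N) = d := by simp
    rw [if_pos this, ← mul_one (1 / (N : ℂ) ^ 3), mul_assoc, one_mul, one_div_mul_one_div, ← mul_pow]
    congr 2
    push_cast
    field_simp
    ring
  · intro n hn
    rw [Function.mem_support] at hn
    have hd : (n : ZMod N) = d := by
      by_contra h; simp [h] at hn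
    have : ((n - d.val : ℤ) : ZMod N) = 0 := by simp [hd]
    rw [ZMod.intCast_zmod_eq_zero_iff_dvd] at this
    obtain ⟨l, hl⟩ := this
    exact ⟨l, by simp only; omega⟩

lemma psi_val {N : ℕ} [NeZero N] (d : ZMod N) :
    ZMod.stdAddChar d = Complex.exp (2 * π * Complex.I * d.val / N) := by
  have := ZMod.stdAddChar_coe (N := N) (d.val : ℤ)
  simpa using this

lemma pS_zero {N : ℕ} [NeZero N] (d : ZMod N) :
    pS d 0 = lam / (N : ℂ) ^ 3 * Phi (ZMod.stdAddChar d) := by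
  have hN : (N : ℂ) ≠ 0 := by exact_mod_cast NeZero.ne N
  rcases eq_or_ne d 0 with rfl | hd
  · have := pS_neg (0 : ZMod N) 0
    rw [neg_zero, neg_zero] at this
    have h0 : pS (0 : ZMod N) 0 = 0 := by linear_combination this / 2
    rw [h0]; simp [Phi]
  · have := lip_real ((d.val : ℝ) / N) (by
      intro n h
      have hN : (N : ℝ) ≠ 0 := by exact_mod_cast NeZero.ne N
      field_simp at h
      have h2 : (d.val : ℤ) + N * n = 0 := by exact_mod_cast h
      apply hd
      have := congrArg (fun x : ℤ => (x : ZMod N)) h2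
      simpa using this)
    rw [pS_eq, psi_val]
    push_cast at this
    rw [zero_add, this, mul_div_assoc]
    ring

lemma pS_uhp {N : ℕ} [NeZero N] (d : ZMod N) (τ : ℍ) (m : ℕ+) :
    pS d (m * τ) = lam / (N : ℂ) ^ 3 * ∑' n : ℕ+, (n : ℂ) ^ 2 * (ZMod.stdAddChar d) ^ (n : ℕ) *
      𝕢 N τ ^ (m * n : ℕ) := by
  have hN : (N : ℂ) ≠ 0 := by exact_mod_cast NeZero.ne N
  have hN' : (0 : ℝ) < N := by exact_mod_cast Nat.pos_of_ne_zero (NeZero.ne N)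
  have him : 0 < ((m * τ + d.val : ℂ) / N).im := by
    have : ((m * τ + d.val : ℂ) / N).im = m * τ.im / N := by
      rw [show (N : ℂ) = ((N : ℝ) : ℂ) by simp, Complex.div_ofReal_im, Complex.add_im, Complex.natCast_im, add_zero]
      simp
    rw [this]
    have := τ.im_pos
    positivity
  have := EisensteinSeries.qExpansion_identity_pnat (k := 2) (by norm_num) ⟨_, him⟩
  rw [pS_eq]
  simp only at this
  rw [this, psi_val]
  simp only [lam, Nat.factorial]
  rw [← mul_assoc]
  congr 1
  · push_cast; ring
  · refine tsum_congr fun n => ?_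
    rw [mul_assoc ((n : ℂ) ^ 2), Function.Periodic.qParam, mul_comm (m : ℕ) (n : ℕ), pow_mul', ← mul_pow, ← Complex.exp_nat_mul _ (m : ℕ),
      ← Complex.exp_add]
    congr 3
    push_cast
    field_simp
    ring

/-- constant term -/
def eC {N : ℕ} [NeZero N] (v : Fin 2 → ZMod N) : ℂ :=
  if v 0 = 0 then Phi (ZMod.stdAddChar (v 1)) else 0

/-- the other coefficients -/
def eD {N : ℕ} [NeZero N] (v : Fin 2 → ZMod N) (p : ℕ+ × ℕ+) : ℂ :=
  (p.2 : ℂ) ^ 2 * ((if ((p.1 : ℕ) : ZMod N) = v 0 then (ZMod.stdAddChar (v 1)) ^ (p.2 : ℕ) else 0)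
    - (if -((p.1 : ℕ) : ZMod N) = v 0 then (ZMod.stdAddChar (-v 1)) ^ (p.2 : ℕ) else 0))

lemma psi_norm {N : ℕ} [NeZero N] (d : ZMod N) : ‖(ZMod.stdAddChar d : ℂ)‖ = 1 := by
  rw [ZMod.stdAddChar_apply]; exact Circle.norm_coe _

lemma eD_bound {N : ℕ} [NeZero N] (v : Fin 2 → ZMod N) (p : ℕ+ × ℕ+) :
    ‖eD v p‖ ≤ 2 * (p.2 : ℝ) ^ 2 := by
  unfold eD
  rw [norm_mul, norm_pow, Complex.norm_natCast, mul_comm]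
  gcongr
  refine (norm_sub_le _ _).trans ?_
  have h1 : ∀ (P : Prop) [Decidable P] (d : ZMod N) (n : ℕ), 
      ‖(if P then (ZMod.stdAddChar d : ℂ) ^ n else 0)‖ ≤ 1 := by
    intro P _ d n
    split_ifs
    · rw [norm_pow, psi_norm, one_pow]
    · simp
  have := h1 (((p.1 : ℕ) : ZMod N) = v 0) (v 1) p.2
  have := h1 (-((p.1 : ℕ) : ZMod N) = v 0) (-v 1) p.2
  linarith

lemma norm_q {N : ℕ} [NeZero N] (τ : ℍ) : ‖𝕢 N τ‖ < 1 :=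
  Function.Periodic.norm_qParam_lt_one (by exact_mod_cast Nat.pos_of_ne_zero (NeZero.ne N)) τ.im_pos

lemma eD_summable {N : ℕ} [NeZero N] (v : Fin 2 → ZMod N) (τ : ℍ) :
    Summable fun p : ℕ+ × ℕ+ => eD v p * 𝕢 N τ ^ (p.1 * p.2 : ℕ) := by
  have h := (summable_prod_mul_pow (𝕜 := ℂ) 2 (norm_q (N := N) τ)).norm.mul_left 2
  refine Summable.of_norm_bounded h fun p => ?_
  rw [norm_mul, norm_mul, norm_pow, norm_pow, Complex.norm_natCast, ← mul_assoc]
  gcongr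
  exact eD_bound v p

lemma psi_summable {N : ℕ} [NeZero N] (d : ZMod N) (τ : ℍ) (m : ℕ+) :
    Summable fun n : ℕ+ => (n : ℂ) ^ 2 * (ZMod.stdAddChar d) ^ (n : ℕ) * 𝕢 N τ ^ (m * n : ℕ) := by
  have h := (summable_prod_mul_pow (𝕜 := ℂ) 2 (norm_q (N := N) τ)).norm.prod_factor m
  refine Summable.of_norm_bounded h fun n => ?_
  simp only [norm_mul, norm_pow, psi_norm, one_pow, mul_one]
  rfl

lemma eX_eq {N : ℕ} [NeZero N] (v : Fin 2 → ZMod N) (τ : ℍ) :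
    (eX v τ = (N : ℂ) ^ 3 / lam * ∑' m : ℤ, if (m : ZMod N) = v 0 then pS (v 1) (m * τ) else 0) ∧
    Summable fun m : ℤ => if (m : ZMod N) = v 0 then pS (v 1) (m * τ) else 0 := by
  have hs : Summable fun p : Fin 2 → ℤ => 
      if red N p = v then EisensteinSeries.eisSummand 3 p τ else 0 := by
    refine Summable.of_norm_bounded (summable_eisSummand (k := 3) (by norm_num) τ).norm fun p => ?_
    split_ifs
    · rfl
    · simp
  rw [← (finTwoArrowEquiv ℤ).symm.summable_iff] at hs
  have he : ∀ m : ℤ, (∑' n : ℤ, if red N ![m, n] = v then EisensteinSeries.eisSummand 3 ![m, n] τ else 0) =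
      if (m : ZMod N) = v 0 then pS (v 1) (m * τ) else 0 := by
    intro m
    have hr : ∀ n : ℤ, red N ![m, n] = v ↔ (m : ZMod N) = v 0 ∧ (n : ZMod N) = v 1 := by
      intro n
      rw [funext_iff, Fin.forall_fin_two]; rfl
    simp only [hr]
    split_ifs with h
    · unfold pS
      refine tsum_congr fun n => ?_
      simp only [h, true_and]
      congr 1
      simp only [EisensteinSeries.eisSummand]
      simp [zpow_neg]
    · simp [h]
  constructor
  · unfold eX
    rw [← (finTwoArrowEquiv ℤ).symm.tsum_eq]
    congr 1
    exact hs.tsum_prod.trans (tsum_congr he)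
  · exact hs.prod.congr fun m => he m

lemma eX_hasSum {N : ℕ} [NeZero N] (v : Fin 2 → ZMod N) (τ : ℍ) :
    HasSum (fun p : ℕ+ × ℕ+ => eD v p * 𝕢 N τ ^ (p.1 * p.2 : ℕ)) (eX v τ - eC v) := by
  obtain ⟨h1, h2⟩ := eX_eq v τ
  have hN : (N : ℂ) ≠ 0 := by exact_mod_cast NeZero.ne N
  have hl := lam_ne
  have hs := eD_summable v τ
  convert hs.hasSum using 1
  have hT := tsum_int_eq_zero_add_tsum_pnat h2
  have hs1 : Summable fun m : ℕ+ => if (((m : ℕ) : ℤ) : ZMod N) = v 0 then pS (v 1) (((m : ℕ) : ℤ) * τ) else 0 :=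
    h2.comp_injective (i := fun m : ℕ+ => ((m : ℕ) : ℤ)) (fun a b hab => by simpa using hab)
  have hs2 : Summable fun m : ℕ+ => if ((-((m : ℕ) : ℤ) : ℤ) : ZMod N) = v 0 then pS (v 1) ((-((m : ℕ) : ℤ) : ℤ) * τ) else 0 :=
    h2.comp_injective (i := fun m : ℕ+ => -((m : ℕ) : ℤ)) (fun a b hab => by simpa using hab)
  rw [hs.tsum_prod, h1, hT, add_assoc, ← hs1.tsum_add hs2, mul_add, ← tsum_mul_left]
  have hc : (N : ℂ) ^ 3 / lam * (if ((0 : ℤ) : ZMod N) = v 0 then pS (v 1) ((0 : ℤ) * τ) else 0) = eC v := by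
    simp only [Int.cast_zero, zero_mul, pS_zero, eC, eq_comm (a := (0 : ZMod N))]
    split_ifs
    · field_simp
    · simp
  rw [hc, add_sub_cancel_left]
  refine tsum_congr fun m => ?_
  simp only [eD, sub_mul, mul_sub, mul_ite, ite_mul, mul_zero, zero_mul]
  have e1 := psi_summable (v 1) τ m
  have e2 := psi_summable (-v 1) τ m
  rw [Summable.tsum_sub]
  · simp only [Int.cast_neg, Int.cast_natCast, neg_mul, pS_neg, pS_uhp, mul_add]
    rw [sub_eq_add_neg]
    congr 1
    · split_ifs
      · field_simp
      · simp
    · split_ifs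
      · field_simp
      · simp
  · split_ifs
    · exact e1
    · exact summable_zero
  · split_ifs
    · exact e2
    · exact summable_zero

lemma fin_fibers (r : ℕ) : {p : ℕ+ × ℕ+ | (p.1 * p.2 : ℕ) = r}.Finite := by
  rcases Nat.eq_zero_or_pos r with rfl | hr
  · convert Set.finite_empty
    ext p; simp
  refine Set.Finite.subset ((Set.finite_Iic (⟨r, hr⟩ : ℕ+)).prod (Set.finite_Iic (⟨r, hr⟩ : ℕ+))) ?_
  rintro ⟨a, b⟩ h
  have h : (a * b : ℕ) = r := h
  constructor
  · show (a : ℕ) ≤ r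
    rw [← h]; exact Nat.le_mul_of_pos_right _ b.2
  · show (b : ℕ) ≤ r
    rw [← h]; exact Nat.le_mul_of_pos_left _ a.2

lemma exists_t {N : ℕ} [NeZero N] (σ : ℂ ≃+* ℂ) : ∃ t : ZMod N, IsUnit t ∧
    ∀ d : ZMod N, σ (ZMod.stdAddChar d) = ZMod.stdAddChar (t * d) := by
  have hN := NeZero.ne N
  have h1 : IsPrimitiveRoot (ZMod.stdAddChar (1 : ZMod N) : ℂ) N := by
    have h := ZMod.stdAddChar_coe (N := N) 1
    rw [Int.cast_one] at h
    rw [h]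
    simpa using Complex.isPrimitiveRoot_exp N hN
  have h2 := h1.map_of_injective σ.injective
  obtain ⟨i, hi, hc, he⟩ := (h1.isPrimitiveRoot_iff).1 h2
  refine ⟨(i : ZMod N), (ZMod.isUnit_iff_coprime i N).2 hc, fun d => ?_⟩
  have h3 : ∀ m : ℕ, (ZMod.stdAddChar (m : ZMod N) : ℂ) = ZMod.stdAddChar (1 : ZMod N) ^ m := by
    intro m
    rw [← AddChar.map_nsmul_eq_pow, nsmul_one]
  obtain ⟨m, rfl⟩ := ZMod.natCast_zmod_surjective d
  rw [← Nat.cast_mul, h3, h3, map_pow, ← he, ← pow_mul]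

/-- the diagonal action -/
def diagT {N : ℕ} (t : ZMod N) (v : Fin 2 → ZMod N) : Fin 2 → ZMod N := ![v 0, t * v 1]

lemma eX_relSub {N : ℕ} [NeZero N] {σ : ℂ ≃+* ℂ} {t : ZMod N}
    (ht : ∀ d : ZMod N, σ (ZMod.stdAddChar d) = ZMod.stdAddChar (t * d)) (v : Fin 2 → ZMod N) :
    (eX v, eX (diagT t v)) ∈ relSub N σ := by
  have h := relSub_of_hasSum (N := N) (σ := σ) (fun p : ℕ+ × ℕ+ => (p.1 * p.2 : ℕ)) fin_fibers (eD v)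
    (eD (diagT t v)) (by
      intro p
      simp only [eD, diagT, map_mul, map_pow, map_sub, map_natCast, apply_ite σ, map_zero, ht]
      simp) (fun τ => eX v τ - eC v) (fun τ => eX (diagT t v) τ - eC (diagT t v))
    (eX_hasSum v) (eX_hasSum _)
  have h2 := relSub_const (N := N) (σ := σ) (eC v)
  have h3 : σ (eC v) = eC (diagT t v) := by
    simp only [eC, diagT, apply_ite σ, Phi, map_zero, map_mul, map_add, map_one, map_div₀, map_pow, map_sub, ht]
    simp
  rw [h3] at h2
  have := add_mem h h2
  convert this using 1
  ext τ <;> simp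

lemma eX_expSub {N : ℕ} [NeZero N] (v : Fin 2 → ZMod N) :
    ∃ p : PowerSeries ℂ, p.coeff 0 = eC v ∧ (eX v, p) ∈ expSub N := by
  have h := expSub_of_hasSum (N := N) (fun p : ℕ+ × ℕ+ => (p.1 * p.2 : ℕ)) fin_fibers (eD v) 
    (fun τ => eX v τ - eC v) (eX_hasSum v)
  have := expSub_add h (expSub_const (eC v))
  refine ⟨(PowerSeries.mk fun r => ∑ i ∈ (fin_fibers r).toFinset, eD v i) + PowerSeries.C (eC v), ?_, ?_⟩
  rotate_left
  · convert this using 2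
    ext τ; simp
  · simp only [map_add, PowerSeries.coeff_mk, PowerSeries.coeff_zero_C, add_eq_right]
    apply Finset.sum_eq_zero
    intro p hp
    simp at hp

lemma Phi_inj {w w' : ℂ} (hw : ‖w‖ = 1) (hw' : ‖w'‖ = 1) (h1 : w ≠ 1) (h1' : w' ≠ 1)
    (h : Phi w = Phi w') : w = w' := by
  have key : ∀ z : ℂ, ‖z‖ = 1 → z ≠ 1 → ∃ y : ℝ, 1 + z = Complex.I * y * (1 - z) ∧ 
      Phi z = - Complex.I * (y * (y ^ 2 + 1)) / 4 := by
    intro z hz hz1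
    have hne : 1 - z ≠ 0 := sub_ne_zero.2 hz1.symm
    have hz0 : z ≠ 0 := by rintro rfl; simp at hz
    set s := (1 + z) / (1 - z) with hs
    have hconj : (starRingEnd ℂ) z = z⁻¹ := by rw [Complex.inv_eq_conj hz]
    have hs' : (starRingEnd ℂ) s = - s := by
      have h3 : 1 - z⁻¹ ≠ 0 := by
        intro h; apply hne
        have : z⁻¹ = 1 := (sub_eq_zero.1 h).symm
        rw [inv_eq_one.1 this]; simp
      have h4 : z - 1 ≠ 0 := sub_ne_zero.2 hz1
      rw [hs, map_div₀, map_add, map_sub, map_one, hconj]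
      have : (1 + z⁻¹) / (1 - z⁻¹) = (z + 1) / (z - 1) := by
        rw [div_eq_div_iff h3 h4]; field_simp
      rw [this, div_eq_iff h4, ← neg_sub 1 z, neg_mul_neg, div_mul_cancel₀ _ hne, add_comm]
    have hre : s.re = 0 := by
      have := congrArg Complex.re hs'
      simp at this; linarith
    have hsI : s = Complex.I * s.im := by
      apply Complex.ext <;> simp [hre]
    refine ⟨s.im, ?_, ?_⟩
    · rw [← hsI, hs, div_mul_cancel₀ _ hne]
    · have : Phi z = s * (s ^ 2 - 1) / 4 := by
        rw [Phi, hs]; field_simp; ring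
      rw [this, hsI]
      have hI : Complex.I ^ 2 = -1 := Complex.I_sq
      simp only [Complex.I_mul_im, Complex.ofReal_re, mul_pow, hI]
      ring
  obtain ⟨y, hy, hp⟩ := key w hw h1
  obtain ⟨y', hy', hp'⟩ := key w' hw' h1'
  have he : ((y * (y ^ 2 + 1) : ℝ) : ℂ) = ((y' * (y' ^ 2 + 1) : ℝ) : ℂ) := by
    rw [hp, hp'] at h
    push_cast
    have : Complex.I * (y * (y ^ 2 + 1) - y' * (y' ^ 2 + 1)) = 0 := by linear_combination -4 * h
    have := (mul_eq_zero.1 this).resolve_left Complex.I_ne_zero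
    linear_combination this
  have he := Complex.ofReal_injective he
  have hyy : y = y' := by
    have : (y - y') * (y ^ 2 + y * y' + y' ^ 2 + 1) = 0 := by linear_combination he
    rcases mul_eq_zero.1 this with h | h
    · linarith
    · nlinarith [sq_nonneg (y + y'), sq_nonneg y, sq_nonneg y']
  subst hyy
  have h2 : (1 + Complex.I * y) ≠ 0 := by
    intro h
    have := congrArg Complex.re h
    simp at this
  have : (1 + Complex.I * y) * (w - w') = 0 := by linear_combination hy - hy'
  exact sub_eq_zero.1 ((mul_eq_zero.1 this).resolve_left h2)

lemma eX_sep {N : ℕ} [NeZero N] (hN : 3 ≤ N) {d : ZMod N} (hd : IsUnit d) {w : Fin 2 → ZMod N}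
    (h : eX ![0, d] = eX w) : ![0, d] = w := by
  obtain ⟨p, hp, hp'⟩ := eX_expSub ![0, d]
  obtain ⟨q, hq, hq'⟩ := eX_expSub w
  rw [h] at hp'
  have hpq := expSub_unique hp' hq'
  have hc : eC ![0, d] = eC w := by rw [← hp, ← hq, hpq]
  haveI : Fact (1 < N) := ⟨by omega⟩
  have h0 : (ZMod.stdAddChar (0 : ZMod N) : ℂ) = 1 := AddChar.map_zero_eq_one _
  have hinj := ZMod.injective_stdAddChar (N := N)
  have hne1 : (ZMod.stdAddChar d : ℂ) ≠ 1 := by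
    rw [← h0]
    intro h
    exact hd.ne_zero (hinj h)
  have hne2 : (ZMod.stdAddChar d : ℂ) ≠ -1 := by
    intro h
    have h2 : (ZMod.stdAddChar (2 * d) : ℂ) = 1 := by
      rw [two_mul, AddChar.map_add_eq_mul, h]; norm_num
    rw [← h0] at h2
    have h3 := (hd.mul_left_eq_zero).1 (hinj h2)
    have h4 : ((2 : ℕ) : ZMod N) = 0 := by exact_mod_cast h3
    rw [ZMod.natCast_eq_zero_iff] at h4
    have := Nat.le_of_dvd (by norm_num) h4
    omega
  have hP : Phi (ZMod.stdAddChar d) ≠ 0 := by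
    unfold Phi
    have hz0 : (ZMod.stdAddChar d : ℂ) ≠ 0 := by
      intro h; have := psi_norm d; rw [h] at this; simp at this
    refine div_ne_zero (mul_ne_zero hz0 ?_) (pow_ne_zero _ (sub_ne_zero.2 hne1.symm))
    intro h; apply hne2; linear_combination h
  have hcd : eC ![0, d] = Phi (ZMod.stdAddChar d) := by simp [eC]
  rw [hcd] at hc
  unfold eC at hc
  split_ifs at hc with hw
  · have hw1 : (ZMod.stdAddChar (w 1) : ℂ) ≠ 1 := by
      intro h
      rw [h] at hc
      apply hP; rw [hc]; simp [Phi]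
    have := hinj (Phi_inj (psi_norm _) (psi_norm _) hne1 hw1 hc)
    ext j
    fin_cases j
    · simp [hw]
    · simpa using this
  · exact absurd hc hP

/-- Lagrange type polynomial -/
def PP {V R : Type} [Fintype V] [DecidableEq V] [CommRing R] (φ x : V → R) : Polynomial R :=
  ∑ v, Polynomial.C (φ v) * ∏ w ∈ Finset.univ.erase v, (Polynomial.X - Polynomial.C (x w))

lemma PP_map {V R S : Type} [Fintype V] [DecidableEq V] [CommRing R] [CommRing S] (h : R →+* S) (φ x : V → R) :
    (PP φ x).map h = PP (fun v => h (φ v)) (fun v => h (x v)) := by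
  simp [PP, Polynomial.map_sum, Polynomial.map_prod]

lemma PP_eval {V R : Type} [Fintype V] [DecidableEq V] [CommRing R] (φ x : V → R) (u : V) :
    (PP φ x).eval (x u) = φ u * ∏ w ∈ Finset.univ.erase u, (x u - x w) := by
  simp only [PP, Polynomial.eval_finsetSum, Polynomial.eval_mul, Polynomial.eval_C, Polynomial.eval_prod,
    Polynomial.eval_sub, Polynomial.eval_X]
  refine Finset.sum_eq_single u (fun v _ hv => ?_) (by simp)
  rw [Finset.prod_eq_zero (i := u)]
  · simp
  · simp [hv.symm]
  · simp

lemma prod_erase_equiv {V R : Type} [Fintype V] [DecidableEq V] [CommRing R] (e : V ≃ V) (h : V → R) (v : V) :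
    ∏ w ∈ Finset.univ.erase v, h (e w) = ∏ w ∈ Finset.univ.erase (e v), h w := by
  refine Finset.prod_equiv e (fun w => ?_) (fun w _ => rfl)
  simp

lemma PP_scale {V R : Type} [Fintype V] [DecidableEq V] [CommRing R] (φ x : V → R) (e : V ≃ V) (a b : R) :
    (PP (fun v => a * φ (e v)) (fun v => b * x (e v))).comp (Polynomial.C b * Polynomial.X) =
      Polynomial.C (a * b ^ (Fintype.card V - 1)) * PP φ x := by
  rw [PP, PP, Polynomial.sum_comp, Finset.mul_sum]
  refine Eq.trans (Finset.sum_congr rfl fun v _ => ?_) (e.sum_comp _)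
  rw [Polynomial.mul_comp, Polynomial.C_comp, Polynomial.prod_comp,
    ← prod_erase_equiv e (fun w => Polynomial.X - Polynomial.C (x w))]
  have : ∀ w ∈ Finset.univ.erase v, (Polynomial.X - Polynomial.C (b * x (e w))).comp (Polynomial.C b * Polynomial.X)
      = Polynomial.C b * (Polynomial.X - Polynomial.C (x (e w))) := by
    intro w _
    simp [mul_sub]
  rw [Finset.prod_congr rfl this, Finset.prod_mul_distrib, Finset.prod_const,
    Finset.card_erase_of_mem (Finset.mem_univ _), Finset.card_univ]
  simp only [map_mul, map_pow]
  ring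

/-- holomorphic, bounded at infinity -/
def hbSub : Subring (ℍ → ℂ) where
  carrier := {F | MDiff F ∧ IsBoundedAtImInfty F}
  mul_mem' hx hy := ⟨hx.1.mul hy.1, hx.2.mul hy.2⟩
  add_mem' hx hy := ⟨hx.1.add hy.1, hx.2.add hy.2⟩
  one_mem' := ⟨mdifferentiable_const, Filter.const_boundedAtFilter _ (1 : ℂ)⟩
  zero_mem' := ⟨mdifferentiable_const, Filter.const_boundedAtFilter _ (0 : ℂ)⟩
  neg_mem' hx := ⟨hx.1.neg, hx.2.neg⟩

lemma PP_hb {V : Type} [Fintype V] [DecidableEq V] (φ x : V → ℍ → ℂ) (hφ : ∀ v, φ v ∈ hbSub)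
    (hx : ∀ v, x v ∈ hbSub) (j : ℕ) : (PP φ x).coeff j ∈ hbSub := by
  have : PP φ x = (PP (fun v => (⟨φ v, hφ v⟩ : hbSub)) (fun v => ⟨x v, hx v⟩)).map hbSub.subtype := by
    rw [PP_map]; rfl
  rw [this, Polynomial.coeff_map]
  exact Subtype.prop _

/-- level one form from its properties -/
def mkForm (k : ℤ) (T : ℍ → ℂ) (h : T ∈ hbSub) (hT : WInv k T) : ModularForm 𝒮ℒ k :=
  have hsl : ∀ g : SL(2, ℤ), T ∣[k] g = T := by
    intro g
    ext τ
    rw [ModularForm.SL_slash_apply, hT g τ, mul_comm, ← mul_assoc, ← zpow_add₀ (denom_ne_zero _ _)]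
    simp
  { toFun := T
    slash_action_eq' := by
      rintro _ ⟨g, rfl⟩
      exact hsl g
    holo' := h.1
    bdd_at_cusps' := by
      intro c hc
      rw [OnePoint.isBoundedAt_iff_forall_SL2Z hc]
      intro g _
      rw [hsl g]
      exact h.2 }

lemma form_slash_hb {N : ℕ} [NeZero N] {k : ℤ} (f : ModularForm (Gamma1 N) k) (g : SL(2, ℤ)) :
    ⇑f ∣[k] g ∈ hbSub := by
  constructor
  · exact (ModularFormClass.holo f).slash k (g : GL (Fin 2) ℝ)
  · have hc : IsCusp ((g : GL (Fin 2) ℝ) • OnePoint.infty) (Gamma1 N : Subgroup (GL (Fin 2) ℝ)) := by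
      rw [Subgroup.IsArithmetic.isCusp_iff_isCusp_SL2Z, isCusp_SL2Z_iff']
      exact ⟨g, rfl⟩
    exact ModularFormClass.bdd_at_cusps f hc _ rfl

/-- translates indexed by vectors -/
def fV {N : ℕ} {k : ℤ} (f : ModularForm (Gamma1 N) k) (v : Fin 2 → ZMod N) : ℍ → ℂ :=
  open Classical in
  if h : ∃ g : SL(2, ℤ), act ![0, 1] g = v then ⇑f ∣[k] h.choose else 0

lemma mem_Gamma1_of_act {N : ℕ} {g : SL(2, ℤ)} (h : act (N := N) ![0, 1] g = ![0, 1]) : g ∈ Gamma1 N := by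
  have h0 := congrFun h 0
  have h1 := congrFun h 1
  simp [act] at h0 h1
  rw [Gamma1_mem]
  have hd := congrArg (fun x : ℤ => (x : ZMod N)) (Matrix.det_fin_two (g : Matrix (Fin 2) (Fin 2) ℤ))
  simp only [Matrix.SpecialLinearGroup.det_coe] at hd
  push_cast at hd
  rw [h0, h1] at hd
  refine ⟨?_, h1, h0⟩
  simpa using hd.symm

lemma fV_act {N : ℕ} {k : ℤ} (f : ModularForm (Gamma1 N) k) (g : SL(2, ℤ)) :
    fV f (act ![0, 1] g) = ⇑f ∣[k] g := by
  have h : ∃ g' : SL(2, ℤ), act (N := N) ![0, 1] g' = act ![0, 1] g := ⟨g, rfl⟩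
  unfold fV
  rw [dif_pos h]
  have hs := h.choose_spec
  set g' := h.choose
  have hm : g' * g⁻¹ ∈ Gamma1 N := by
    apply mem_Gamma1_of_act
    rw [← act_mul, hs, act_mul, mul_inv_cancel, act_one]
  have hi : ⇑f ∣[k] (g' * g⁻¹) = ⇑f :=
    SlashInvariantForm.slash_action_eqn f _ (Subgroup.mem_map_of_mem _ hm)
  calc ⇑f ∣[k] g' = ⇑f ∣[k] (g' * g⁻¹ * g) := by rw [inv_mul_cancel_right]
    _ = ⇑f ∣[k] g := by rw [SlashAction.slash_mul, hi]

lemma slash_smul_eq {k : ℤ} (F : ℍ → ℂ) (g : SL(2, ℤ)) (τ : ℍ) :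
    F (g • τ) = denom g τ ^ k * (F ∣[k] g) τ := by
  rw [ModularForm.SL_slash_apply, mul_comm, mul_assoc, ← zpow_add₀ (denom_ne_zero _ _)]
  simp

lemma fV_smul {N : ℕ} {k : ℤ} (f : ModularForm (Gamma1 N) k) (v : Fin 2 → ZMod N) (g : SL(2, ℤ)) (τ : ℍ) :
    fV f v (g • τ) = denom g τ ^ k * fV f (act v g) τ := by
  by_cases h : ∃ g' : SL(2, ℤ), act ![0, 1] g' = v
  · obtain ⟨g', rfl⟩ := h
    rw [act_mul, fV_act, fV_act, slash_smul_eq (k := k) (⇑f ∣[k] g') g τ, SlashAction.slash_mul]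
  · have h' : ¬ ∃ g' : SL(2, ℤ), act ![0, 1] g' = act v g := by
      rintro ⟨g', hg'⟩
      apply h
      exact ⟨g' * g⁻¹, by rw [← act_mul, hg', act_mul, mul_inv_cancel, act_one]⟩
    unfold fV
    rw [dif_neg h, dif_neg h']
    simp

lemma fV_hb {N : ℕ} [NeZero N] {k : ℤ} (f : ModularForm (Gamma1 N) k) (v : Fin 2 → ZMod N) : fV f v ∈ hbSub := by
  unfold fV
  split_ifs
  · exact form_slash_hb f _
  · exact zero_mem _

lemma eX_hb {N : ℕ} [NeZero N] (v : Fin 2 → ZMod N) : eX v ∈ hbSub := by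
  obtain ⟨p, _, hp⟩ := eX_expSub v
  exact ⟨expSub_holo hp, expSub_bdd hp⟩

/-- `n - 1` -/
def nn (N : ℕ) [NeZero N] : ℕ := Fintype.card (Fin 2 → ZMod N) - 1

lemma coeff_WInv {N : ℕ} [NeZero N] {k : ℤ} (f : ModularForm (Gamma1 N) k) (j : ℕ) :
    WInv (k + 3 * nn N - 3 * j) ((PP (fV f) eX).coeff j) := by
  intro g τ
  have hc : ∀ (τ : ℍ), (PP (fV f) eX).coeff j τ = (PP (fun v => fV f v τ) (fun v => eX v τ)).coeff j := by
    intro τ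
    have := PP_map (Pi.evalRingHom (fun _ : ℍ => ℂ) τ) (fV f) eX
    have := congrArg (fun p => p.coeff j) this
    simpa using this
  rw [hc, hc]
  have h := PP_scale (fun v => fV f v τ) (fun v => eX v τ) (actEquiv g) (denom g τ ^ k) (denom g τ ^ 3)
  have h := congrArg (fun p => p.coeff j) h
  simp only [Polynomial.comp_C_mul_X_coeff, Polynomial.coeff_C_mul] at h
  have e1 : (fun v => fV f v (g • τ)) = fun v => denom g τ ^ k * fV f (actEquiv g v) τ := by
    ext v; rw [fV_smul]; rfl
  have e2 : (fun v : Fin 2 → ZMod N => eX v (g • τ)) = fun v => denom g τ ^ 3 * eX (actEquiv g v) τ := by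
    ext v; rw [eX_smul]; rfl
  rw [e1, e2]
  have hd : denom (g : GL (Fin 2) ℝ) τ ≠ 0 := denom_ne_zero _ _
  have h3 : ((denom (g : GL (Fin 2) ℝ) τ) ^ 3) ^ j ≠ 0 := pow_ne_zero _ (pow_ne_zero _ hd)
  apply mul_right_cancel₀ h3
  rw [h]
  have e4 : ∀ m : ℕ, (denom (g : GL (Fin 2) ℝ) τ) ^ (3 * (m : ℤ)) = (denom (g : GL (Fin 2) ℝ) τ ^ 3) ^ m := by
    intro m
    rw [← pow_mul]
    norm_cast
  rw [zpow_sub₀ hd, zpow_add₀ hd, e4, e4, nn]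
  field_simp

/-- `diagT` as a permutation -/
def diagEquiv {N : ℕ} (t : (ZMod N)ˣ) : (Fin 2 → ZMod N) ≃ (Fin 2 → ZMod N) where
  toFun v := diagT t v
  invFun v := diagT (t⁻¹ : (ZMod N)ˣ) v
  left_inv v := by ext j; fin_cases j <;> simp [diagT]
  right_inv v := by ext j; fin_cases j <;> simp [diagT]

/-- the product of differences -/
def DD {N : ℕ} [NeZero N] (u : Fin 2 → ZMod N) : ℍ → ℂ := ∏ w ∈ Finset.univ.erase u, (eX u - eX w)

lemma DD_smul {N : ℕ} [NeZero N] (u : Fin 2 → ZMod N) (g : SL(2, ℤ)) (τ : ℍ) :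
    DD u (g • τ) = (denom g τ ^ 3) ^ nn N * DD (act u g) τ := by
  simp only [DD, Finset.prod_apply, Pi.sub_apply]
  have := prod_erase_equiv (actEquiv g) (fun w => eX (act u g) τ - eX w τ) u
  change _ = ∏ w ∈ Finset.univ.erase (act u g), (eX (act u g) τ - eX w τ) at this
  rw [← this]
  have hp : (denom g τ ^ 3) ^ nn N = ∏ w ∈ Finset.univ.erase u, denom g τ ^ 3 := by
    rw [Finset.prod_const, Finset.card_erase_of_mem (Finset.mem_univ _), Finset.card_univ, nn]
  rw [hp, ← Finset.prod_mul_distrib]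
  refine Finset.prod_congr rfl fun w _ => ?_
  rw [eX_smul, eX_smul, ← mul_sub]; rfl

lemma DD_hb {N : ℕ} [NeZero N] (u : Fin 2 → ZMod N) : DD u ∈ hbSub :=
  prod_mem fun w _ => sub_mem (eX_hb u) (eX_hb w)

lemma DD_ne {N : ℕ} [NeZero N] (hN : 3 ≤ N) {d : ZMod N} (hd : IsUnit d) : DD ![0, d] ≠ 0 := by
  have key : ∀ s : Finset (Fin 2 → ZMod N), ![0, d] ∉ s → ∏ w ∈ s, (eX ![0, d] - eX w) ≠ 0 := by
    intro s
    induction s using Finset.induction_on with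
    | empty => intro _; simp
    | insert w s hw ih =>
      intro h
      rw [Finset.mem_insert, not_or] at h
      rw [Finset.prod_insert hw]
      intro h0
      rcases mul_eq_zero_holo (sub_mem (eX_hb _) (eX_hb w)).1
        (prod_mem fun w _ => sub_mem (eX_hb ![0, d]) (eX_hb w) : _ ∈ hbSub).1 h0 with h1 | h1
      · exact h.1 (eX_sep hN hd (sub_eq_zero.1 h1))
      · exact ih h.2 h1
  exact key _ (by simp)

lemma core {N : ℕ} [NeZero N] (hN : 3 ≤ N) {k : ℤ} (χ : DirichletCharacter ℂ N)
    (f : ModularForm (Gamma1 N) k)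
    (hχf : ∀ γ : SL(2, ℤ), γ ∈ Gamma0 N → ⇑f ∣[k] γ = χ ((γ 1 1 : ℤ) : ZMod N) • ⇑f)
    (σ : ℂ ≃+* ℂ) (F : ℍ → ℂ) (hF : (⇑f, F) ∈ relSub N σ) (γ : SL(2, ℤ)) (hγ : γ ∈ Gamma0 N) :
    F ∣[k] γ = σ (χ ((γ 1 1 : ℤ) : ZMod N)) • F := by
  obtain ⟨t, htu, ht⟩ := exists_t (N := N) σ
  obtain ⟨t, rfl⟩ := htu
  set P := PP (fV f) eX with hP
  have hform : ∀ j, ∃ T' : ℍ → ℂ, (P.coeff j, T') ∈ relSub 1 σ ∧ WInv (k + 3 * nn N - 3 * j) T' := fun j =>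
    levelOne_conj σ _ (mkForm _ (P.coeff j) (PP_hb _ _ (fV_hb f) eX_hb j) (coeff_WInv f j))
  choose T hT hTw using hform
  -- the conjugated evaluation identity
  have hev : ∀ (u : Fin 2 → ZMod N) (φ' : ℍ → ℂ), (fV f u, φ') ∈ relSub N σ →
      φ' * DD (diagT t u) = ∑ j ∈ Finset.range (P.natDegree + 1), T j * eX (diagT t u) ^ j := by
    intro u φ' hφ
    have h1 := PP_eval (fV f) eX u
    rw [← hP, Polynomial.eval_eq_sum_range] at h1
    have hD : (∏ w ∈ Finset.univ.erase u, (eX u - eX w), DD (diagT t u)) ∈ relSub N σ := by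
      have h2 : DD (diagT t u) = ∏ w ∈ Finset.univ.erase u, (eX (diagT t u) - eX (diagT t w)) :=
        (prod_erase_equiv (diagEquiv t) (fun w => eX (diagT t u) - eX w) u).symm
      have h3 : (∏ w ∈ Finset.univ.erase u, ((eX u, eX (diagT t u)) - (eX w, eX (diagT t w)))) ∈ relSub N σ :=
        prod_mem fun w _ => sub_mem (eX_relSub ht u) (eX_relSub ht w)
      convert h3 using 1
      rw [h2]
      ext1
      · simp [Prod.fst_prod]
      · simp [Prod.snd_prod]
    have hL : (fV f u * ∏ w ∈ Finset.univ.erase u, (eX u - eX w), φ' * DD (diagT t u)) ∈ relSub N σ :=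
      mul_mem hφ hD
    rw [← h1] at hL
    refine relSub_unique hL ?_
    have h4 : (∑ j ∈ Finset.range (P.natDegree + 1), (P.coeff j, T j) * (eX u, eX (diagT t u)) ^ j) ∈ relSub N σ :=
      sum_mem fun j _ => mul_mem (relSub_of_one (hT j)) (pow_mem (eX_relSub ht u) j)
    convert h4 using 1
    ext1
    · simp [Prod.fst_sum]
    · simp [Prod.snd_sum]
  have hγ0 : ((γ 1 0 : ℤ) : ZMod N) = 0 := Gamma0_mem.1 hγ
  set d : ZMod N := ((γ 1 1 : ℤ) : ZMod N) with hd
  have hdu : IsUnit d := by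
    have hdet := congrArg (fun x : ℤ => (x : ZMod N)) (Matrix.det_fin_two (γ : Matrix (Fin 2) (Fin 2) ℤ))
    simp only [Matrix.SpecialLinearGroup.det_coe] at hdet
    push_cast at hdet
    rw [hγ0] at hdet
    refine IsUnit.of_mul_eq_one ((γ 0 0 : ℤ) : ZMod N) ?_
    rw [mul_comm]
    simpa using hdet.symm
  have ha1 : act ![0, 1] γ = ![0, d] := by
    ext j; fin_cases j <;> simp [act, hγ0, hd]
  have ha2 : act (diagT t ![0, 1]) γ = diagT t ![0, d] := by
    ext j; fin_cases j <;> simp [act, hγ0, hd, diagT]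
  have hf1 : fV f ![0, 1] = f := by
    have := fV_act f 1
    rwa [act_one, SlashAction.slash_one] at this
  have hf2 : fV f ![0, d] = (fun _ => χ d) * ⇑f := by
    rw [← ha1, fV_act, hχf γ hγ]; rfl
  have E1 := hev ![0, 1] F (by rw [hf1]; exact hF)
  have E2 := hev ![0, d] ((fun _ => σ (χ d)) * F) (by rw [hf2]; exact mul_mem (relSub_const _) hF)
  have hz : (F ∣[k] γ - σ (χ d) • F) * DD (diagT t ![0, d]) = 0 := by
    ext τ
    have e1 := congrFun E1 (γ • τ)
    have e2 := congrFun E2 τ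
    simp only [Pi.mul_apply, Finset.sum_apply, Pi.pow_apply, DD_smul, eX_smul, ha2, slash_smul_eq (k := k) F γ τ] at e1 e2
    have hs : denom (γ : GL (Fin 2) ℝ) τ ≠ 0 := denom_ne_zero _ _
    set s := denom (γ : GL (Fin 2) ℝ) τ
    have e4 : ∀ m : ℕ, s ^ (3 * (m : ℤ)) = (s ^ 3) ^ m := by
      intro m
      rw [← pow_mul]
      norm_cast
    have e3 : ∑ j ∈ Finset.range (P.natDegree + 1), T j (γ • τ) * (s ^ 3 * eX (diagT t ![0, d]) τ) ^ j
        = s ^ k * (s ^ 3) ^ nn N * ∑ j ∈ Finset.range (P.natDegree + 1), T j τ * eX (diagT t ![0, d]) τ ^ j := by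
      rw [Finset.mul_sum]
      refine Finset.sum_congr rfl fun j _ => ?_
      rw [hTw j γ τ, zpow_sub₀ hs, zpow_add₀ hs, e4, e4, mul_pow]
      field_simp
    rw [e3, ← e2] at e1
    have h5 : s ^ k * (s ^ 3) ^ nn N ≠ 0 := mul_ne_zero (zpow_ne_zero _ hs) (pow_ne_zero _ (pow_ne_zero _ hs))
    apply mul_left_cancel₀ h5
    simp only [Pi.mul_apply, Pi.sub_apply, Pi.smul_apply, smul_eq_mul, Pi.zero_apply]
    linear_combination e1
  obtain ⟨p, _, hp⟩ := hF
  have hFh : MDiff F := expSub_holo hp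
  have hdT : diagT (t : ZMod N) ![0, d] = ![0, t * d] := by simp [diagT]
  have hcm := ((mdifferentiable_const (c := σ (χ d))).mul hFh)
  rcases mul_eq_zero_holo ((hFh.slash k (γ : GL (Fin 2) ℝ)).sub hcm) (DD_hb _).1 hz with h | h
  · exact sub_eq_zero.1 h
  · rw [hdT] at h
    exact absurd h (DD_ne hN (t.isUnit.mul hdu))

lemma unit_case {N : ℕ} [NeZero N] (hN : 3 ≤ N) {k : ℤ} (hk : 1 ≤ k) (χ : DirichletCharacter ℂ N)
    (f : ModularForm (Gamma1 N) k) (hf : f ≠ 0)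
    (hχf : ∀ γ : SL(2, ℤ), γ ∈ Gamma0 N → ⇑f ∣[k] γ = χ ((γ 1 1 : ℤ) : ZMod N) • ⇑f)
    (σ : ℂ ≃+* ℂ) (c' : ℂ) (hF : (⇑f, ⇑f + fun _ => c') ∈ relSub N σ) (u : ℤ) (hu : IsUnit (u : ZMod N)) :
    σ (χ (u : ZMod N)) = χ (u : ZMod N) := by
  have key : ∀ γ : SL(2, ℤ), γ 1 0 = N → ((γ 1 1 : ℤ) : ZMod N) = u → ∀ τ : ℍ,
      c' + ((N : ℂ) * τ + (γ 1 1 : ℤ)) ^ k * (χ u * f τ - σ (χ u) * (f τ + c')) = 0 := by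
    intro γ h0 h1 τ
    have hγ : γ ∈ Gamma0 N := by rw [Gamma0_mem, h0]; simp
    have h := core hN χ f hχf σ _ hF γ hγ
    have h2 := slash_smul_eq (k := k) (⇑f + fun _ => c') γ τ
    have h3 := slash_smul_eq (k := k) (⇑f) γ τ
    rw [h] at h2
    rw [hχf γ hγ] at h3
    have hden : denom (γ : GL (Fin 2) ℝ) τ = (N : ℂ) * τ + (γ 1 1 : ℤ) := by
      rw [ModularGroup.denom_apply, h0]; simp
    rw [hden, h1] at h2 h3
    simp only [Pi.add_apply, Pi.smul_apply, smul_eq_mul] at h2 h3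
    rw [h3] at h2
    linear_combination h2
  -- build the matrices
  have hcop : IsCoprime (N : ℤ) u := by
    obtain ⟨w, hw⟩ := hu.exists_left_inv
    obtain ⟨m, rfl⟩ := ZMod.intCast_surjective w
    have : ((m * u - 1 : ℤ) : ZMod N) = 0 := by push_cast; rw [hw]; ring
    rw [ZMod.intCast_zmod_eq_zero_iff_dvd] at this
    obtain ⟨l, hl⟩ := this
    exact ⟨-l, m, by linear_combination hl⟩
  have hmk : ∀ d : ℤ, IsCoprime (N : ℤ) d → ∃ γ : SL(2, ℤ), γ 1 0 = N ∧ γ 1 1 = d := by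
    rintro d ⟨a, b, hab⟩
    refine ⟨⟨!![b, -a; N, d], ?_⟩, ?_, ?_⟩
    · rw [Matrix.det_fin_two_of]; linear_combination hab
    · simp
    · simp
  obtain ⟨γ₁, h10, h11⟩ := hmk u hcop
  obtain ⟨γ₂, h20, h21⟩ := hmk (u + N * 1) (hcop.add_mul_left_right 1)
  have k1 := key γ₁ h10 (by rw [h11])
  have k2 := key γ₂ h20 (by rw [h21]; simp)
  rw [h11] at k1
  rw [h21] at k2
  have hNp : (0 : ℝ) < N := by exact_mod_cast Nat.pos_of_ne_zero (NeZero.ne N)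
  have hNc : (N : ℂ) ≠ 0 := by exact_mod_cast NeZero.ne N
  have hc : c' = 0 := by
    by_contra hc
    obtain ⟨n, hn⟩ := Int.eq_ofNat_of_zero_le (show 0 ≤ k by omega)
    let τ : ℍ := ⟨⟨-(u : ℝ) / N, 1⟩, one_pos⟩
    have a1 := k1 τ
    have a2 := k2 τ
    set H := χ u * f τ - σ (χ u) * (f τ + c')
    have hH : H ≠ 0 := by
      intro h; rw [h] at a1; apply hc; linear_combination a1
    have hpow : ((N : ℂ) * τ + (u : ℤ)) ^ k = ((N : ℂ) * τ + (u + N * 1 : ℤ)) ^ k := by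
      apply mul_right_cancel₀ hH
      linear_combination a1 - a2
    have hτ : (τ : ℂ) = -(u : ℂ) / N + Complex.I := by
      apply Complex.ext
      · show -(u : ℝ) / N = _
        have : (-(u : ℂ) / N).re = -(u : ℝ) / N := by
          rw [show -(u : ℂ) / N = ((-(u : ℝ) / N : ℝ) : ℂ) by push_cast; rfl, Complex.ofReal_re]
        simp [this]
      · show (1 : ℝ) = _
        have : (-(u : ℂ) / N).im = 0 := by
          rw [show -(u : ℂ) / N = ((-(u : ℝ) / N : ℝ) : ℂ) by push_cast; rfl, Complex.ofReal_im]
        simp [this]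
    have b1 : (N : ℂ) * τ + (u : ℤ) = N * Complex.I := by rw [hτ]; field_simp; ring
    have b2 : (N : ℂ) * τ + (u + N * 1 : ℤ) = N * (1 + Complex.I) := by rw [hτ]; push_cast; field_simp; ring
    rw [b1, b2, hn, zpow_natCast, zpow_natCast, mul_pow, mul_pow] at hpow
    have hpow := congrArg norm (mul_left_cancel₀ (pow_ne_zero _ hNc) hpow)
    rw [norm_pow, norm_pow, Complex.norm_I, one_pow] at hpow
    have h1 : 1 < ‖1 + Complex.I‖ := by
      have : ‖1 + Complex.I‖ ^ 2 = 2 := by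
        rw [Complex.sq_norm, Complex.normSq_apply]; norm_num
      nlinarith [norm_nonneg (1 + Complex.I)]
    have := one_lt_pow₀ h1 (n := n) (by omega)
    linarith
  subst hc
  have hτ : ∃ τ, f τ ≠ 0 := by
    by_contra! h
    apply hf
    ext τ; exact h τ
  obtain ⟨τ, hτ⟩ := hτ
  have a1 := k1 τ
  have hs : (N : ℂ) * τ + (u : ℤ) ≠ 0 := by
    intro h
    have := congrArg Complex.im h
    simp at this
    rcases this with h | h
    · exact NeZero.ne N h
    · exact absurd h τ.im_pos.ne'
  rw [zero_add, add_zero] at a1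
  have := (mul_eq_zero.1 a1).resolve_left (zpow_ne_zero _ hs)
  rw [← sub_mul] at this
  exact (sub_eq_zero.1 ((mul_eq_zero.1 this).resolve_right hτ)).symm

/-- Let `χ` be a Dirichlet character modulo `N` and let `f` be a nonzero
element of `M_k(Γ₀(N), χ)`, i.e. a modular form of weight `k` on `Γ₁(N)` with
`f|_k γ = χ(d)·f` for all `γ = (a,b;c,d) ∈ Γ₀(N)`. Then every field automorphism `σ` of `ℂ`
fixing the Fourier coefficients `a_n(f)`, `n ≥ 1`, fixes `χ(u)` for every integer `u`. -/
theorem stmt_4 (N : ℕ) (hN : 1 ≤ N) (k : ℤ) (hk : 1 ≤ k)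
    (χ : DirichletCharacter ℂ N)
    (f : ModularForm (Gamma1 N) k) (hf : f ≠ 0)
    (hχf : ∀ γ : SL(2, ℤ), γ ∈ Gamma0 N →
      ⇑f ∣[k] γ = χ ((γ 1 1 : ℤ) : ZMod N) • ⇑f)
    (a : ℕ → ℂ) (ha : HasExpansion 1 (⇑f) a)
    (σ : ℂ ≃+* ℂ) (hσ : ∀ n : ℕ, 1 ≤ n → σ (a n) = a n) :
    ∀ u : ℤ, σ (χ (u : ZMod N)) = χ (u : ZMod N) := by
  intro u
  by_cases hu : IsUnit (u : ZMod N)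
  swap
  · rw [χ.map_nonunit hu, map_zero]
  have : NeZero N := ⟨by omega⟩
  rcases lt_or_ge N 3 with h3 | h3
  · have h1 : (u : ZMod N) = 1 := by
      have : ∀ x : (ZMod N)ˣ, x = 1 := by
        have : N = 1 ∨ N = 2 := by omega
        rcases this with rfl | rfl <;> decide
      obtain ⟨x, hx⟩ := hu
      rw [← hx, this x]; rfl
    rw [h1, map_one, map_one]
  · refine unit_case h3 hk χ f hf hχf σ (σ (a 0) - a 0) ?_ u hu
    apply relSub_of_one
    have h := (hasExpansion_iff (N := 1)).1 ha
    refine ⟨PowerSeries.mk a, h, ?_⟩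
    convert expSub_add h (expSub_const (σ (a 0) - a 0)) using 2
    ext n
    rcases n with _ | n
    · simp
    · simp [hσ (n + 1) (by omega)]
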